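/- arXiv:2511.12315 — 7 statements merged into one kernel-verified Lean document; each statement's English description precedes it below -/
import Mathlib

section
/- The map assigning to each finite string s ∈ {L,R}* the rational number reached from the root 0/1 of the Stern–Brocot tree T_SB by following the sequence of left/right child moves in s is a bijection from {L,R}* onto ℚ. Equivalently, every rational number occurs exactly once as the middle component of a triple in the boundary relation B. -/
/-- Fractions are pairs `(numerator, denominator)` of integers; `(-1,0)` is `-∞`, `(1,0)` is `∞`. -/
def mediant (p q : ℤ × ℤ) : ℤ × ℤ := (p.1 + q.1, p.2 + q.2)

/-- The Stern–Brocot boundary relation `B`: `SBB l m r` means `(l, m, r) ∈ B`. -/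
inductive SBB : ℤ × ℤ → ℤ × ℤ → ℤ × ℤ → Prop
  | base : SBB (-1, 0) (0, 1) (1, 0)
  | left {l m r : ℤ × ℤ} : SBB l m r → SBB l (mediant l m) m
  | right {l m r : ℤ × ℤ} : SBB l m r → SBB m (mediant m r) r

/-- One step down the Stern–Brocot tree; the state is the triple
(left bound, node, right bound); `false` is an L-move, `true` an R-move. -/
def sbStep : (ℤ × ℤ) × (ℤ × ℤ) × (ℤ × ℤ) → Bool → (ℤ × ℤ) × (ℤ × ℤ) × (ℤ × ℤ)
  | (l, m, _r), false => (l, mediant l m, m)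
  | (_l, m, r), true => (m, mediant m r, r)

/-- Boundary triple of the node reached from the root `0/1` by the path `s ∈ {L,R}*`. -/
def sbTriple (s : List Bool) : (ℤ × ℤ) × (ℤ × ℤ) × (ℤ × ℤ) :=
  s.foldl sbStep ((-1, 0), (0, 1), (1, 0))

/-- The (numerator, denominator) of the node reached by the path `s`. -/
def sbNode (s : List Bool) : ℤ × ℤ := (sbTriple s).2.1

/-- The rational number at the node of the Stern–Brocot tree reached by the path `s`. -/
def sbVal (s : List Bool) : ℚ := ((sbNode s).1 : ℚ) / ((sbNode s).2 : ℚ)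

/-- The path (string in {L,R}*) whose run-length encoding is the block list `l`,
the first block being in direction `b` (`true` = R, `false` = L). -/
def pathOf (b : Bool) : List ℕ → List Bool
  | [] => []
  | a :: rest => List.replicate a b ++ pathOf (!b) rest

/-- `s` is the path of a convergent fraction of the node with path `t`:
either `s = t`, or `s` corresponds to the first `m` blocks (1 ≤ m ≤ n) of the
run-length (SB-)encoding of `t`. -/
def ConvPath (s t : List Bool) : Prop :=
  s = t ∨ ∃ (b : Bool) (l : List ℕ) (m : ℕ),
    (∀ a ∈ l, 0 < a) ∧ 0 < m ∧ m ≤ l.length ∧ t = pathOf b l ∧ s = pathOf b (l.take m)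

/-- `s` is the path of a strict convergent fraction of the node with path `t`. -/
def StrictConvPath (s t : List Bool) : Prop :=
  ∃ (b : Bool) (l : List ℕ) (m : ℕ),
    (∀ a ∈ l, 0 < a) ∧ 0 < m ∧ m < l.length ∧ t = pathOf b l ∧ s = pathOf b (l.take m)

/-- `p` is a convergent fraction of `r` in the Stern–Brocot tree. -/
def ConvOf (p r : ℚ) : Prop := ∃ s t : List Bool, sbVal s = p ∧ sbVal t = r ∧ ConvPath s t

/-- `r` is a (strict) ancestor of `p` in the Stern–Brocot tree, i.e. `p` is a descendant of `r`. -/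
def IsAncestor (r p : ℚ) : Prop := ∃ s t : List Bool, sbVal s = r ∧ t ≠ [] ∧ sbVal (s ++ t) = p

/-- `(p, q)` is an edge of the Stern–Brocot tree, `q` a child of `p`. -/
def IsEdge (p q : ℚ) : Prop := ∃ (s : List Bool) (d : Bool), sbVal s = p ∧ sbVal (s ++ [d]) = q

/-- An interval of `ℚ`: a nonempty order-convex set. -/
def IsInterval (I : Set ℚ) : Prop :=
  I.Nonempty ∧ ∀ p ∈ I, ∀ q ∈ I, ∀ r : ℚ, p < r → r < q → r ∈ I

/-- An interval partition of `ℚ`: a list of intervals, pointwise increasing, covering `ℚ`. -/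
def IsIntervalPartition (P : List (Set ℚ)) : Prop :=
  (∀ I ∈ P, IsInterval I) ∧
  P.Pairwise (fun I J => ∀ p ∈ I, ∀ q ∈ J, p < q) ∧
  (∀ x : ℚ, ∃ I ∈ P, x ∈ I)

/-- `I` is monochromatic with respect to `γ`: `γ` is constant on `I`. -/
def Monochromatic {S : Type*} (γ : ℚ → S) (I : Set ℚ) : Prop :=
  ∀ p ∈ I, ∀ q ∈ I, γ p = γ q

/-- `γ` is a finite piecewise function. -/
def FinitePW {S : Type*} (γ : ℚ → S) : Prop :=
  ∃ P : List (Set ℚ), IsIntervalPartition P ∧ ∀ I ∈ P, Monochromatic γ I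

/-- `P` is the canonical representation of `γ`: an interval partition into monochromatic
pieces on which `γ` takes different constant values on adjacent pieces. -/
def IsCanonicalRep {S : Type*} (γ : ℚ → S) (P : List (Set ℚ)) : Prop :=
  IsIntervalPartition P ∧ (∀ I ∈ P, Monochromatic γ I) ∧
  P.Chain' (fun I J => ∀ p ∈ I, ∀ q ∈ J, γ p ≠ γ q)

/-- `x ∈ bounds(γ)`: `x` is a (rational) infimum or supremum of an interval of the
canonical representation of `γ`. -/
def IsBound {S : Type*} (γ : ℚ → S) (x : ℚ) : Prop :=
  ∃ P, IsCanonicalRep γ P ∧ ∃ I ∈ P, IsGLB I x ∨ IsLUB I x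

/-- `x` is a left-bound of `γ`: the minimum of some interval of the canonical representation. -/
def IsLeftBound {S : Type*} (γ : ℚ → S) (x : ℚ) : Prop :=
  ∃ P, IsCanonicalRep γ P ∧ ∃ I ∈ P, IsLeast I x

/-- `x` is a right-bound of `γ`: the maximum of some interval of the canonical representation. -/
def IsRightBound {S : Type*} (γ : ℚ → S) (x : ℚ) : Prop :=
  ∃ P, IsCanonicalRep γ P ∧ ∃ I ∈ P, IsGreatest I x

/-- `(p, q)` is a break link of `γ`: an edge of the Stern–Brocot tree such that `p = 0/1`
or the unordered closed interval `⟦p, q⟧` is not monochromatic w.r.t. `γ`. -/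
def IsBreakLink {S : Type*} (γ : ℚ → S) (p q : ℚ) : Prop :=
  IsEdge p q ∧ (p = 0 ∨ ¬ Monochromatic γ (Set.uIcc p q))

/-- `cfval [a₁,…,aₙ] = a₁ + 1/(a₂ + 1/(⋯ + 1/(aₙ + 1)))`. -/
def cfval : List ℕ → ℚ
  | [] => 1
  | [a] => (a : ℚ) + 1
  | a :: b :: rest => (a : ℚ) + 1 / cfval (b :: rest)

/-- The cross product of two fractions; it is positive iff `p < q`, for nonnegative denominators
that are not both zero. -/
def sbCross (p q : ℤ × ℤ) : ℤ := p.2 * q.1 - p.1 * q.2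

/-- Consecutive entries of a boundary triple are unimodular, with a positive denominator
in the middle. -/
structure IsSBTriple (T : (ℤ × ℤ) × (ℤ × ℤ) × (ℤ × ℤ)) : Prop where
  left_den : 0 ≤ T.1.2
  den : 0 < T.2.1.2
  right_den : 0 ≤ T.2.2.2
  left_cross : sbCross T.1 T.2.1 = 1
  right_cross : sbCross T.2.1 T.2.2 = 1

theorem IsSBTriple.root : IsSBTriple ((-1, 0), (0, 1), (1, 0)) := by
  constructor <;> simp [sbCross]

theorem IsSBTriple.step {T : (ℤ × ℤ) × (ℤ × ℤ) × (ℤ × ℤ)} (h : IsSBTriple T) (d : Bool) :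
    IsSBTriple (sbStep T d) := by
  obtain ⟨l, m, r⟩ := T
  obtain ⟨h1, h2, h3, h4, h5⟩ := h
  simp only [sbCross] at *
  cases d <;> constructor <;> simp only [sbStep, mediant, sbCross] <;> lia

theorem IsSBTriple.foldl {T : (ℤ × ℤ) × (ℤ × ℤ) × (ℤ × ℤ)} (h : IsSBTriple T) (s : List Bool) :
    IsSBTriple (s.foldl sbStep T) := by
  induction s generalizing T with
  | nil => exact h
  | cons d s ih => exact ih (h.step d)

/-- Transitivity of the order on fractions expressed through `sbCross`. -/
theorem sbCross_pos_trans {p q x : ℤ × ℤ} (hp : 0 ≤ p.2) (hq : 0 < q.2) (hx : 0 ≤ x.2)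
    (hpq : 0 < sbCross p q) (hqx : 0 < sbCross q x) (hpx : 0 < p.2 ∨ 0 < x.2) :
    0 < sbCross p x := by
  have key : sbCross p x * q.2 = sbCross p q * x.2 + sbCross q x * p.2 := by
    simp only [sbCross]; ring
  refine pos_of_mul_pos_left (b := q.2) ?_ hq.le
  rw [key]
  rcases hpx with h | h <;> positivity

/-- Every node below a boundary triple lies strictly between the two bounds. -/
theorem IsSBTriple.foldl_between {T : (ℤ × ℤ) × (ℤ × ℤ) × (ℤ × ℤ)} (h : IsSBTriple T)
    (s : List Bool) :
    0 < sbCross T.1 (s.foldl sbStep T).2.1 ∧ 0 < sbCross (s.foldl sbStep T).2.1 T.2.2 := by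
  induction s generalizing T with
  | nil => exact ⟨by simp [h.left_cross], by simp [h.right_cross]⟩
  | cons d s ih =>
    have hd := ((h.step d).foldl s).den
    obtain ⟨h1, h2⟩ := ih (h.step d)
    have hl : 0 < sbCross T.1 T.2.1 := by simp [h.left_cross]
    have hr : 0 < sbCross T.2.1 T.2.2 := by simp [h.right_cross]
    cases d
    · exact ⟨h1, sbCross_pos_trans hd.le h.den h.right_den h2 hr (.inl hd)⟩
    · exact ⟨sbCross_pos_trans h.left_den h.den hd.le hl h1 (.inr hd), h2⟩

/-- Nodes in the left subtree are smaller than the node at the top. -/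
theorem IsSBTriple.foldl_left_lt {T : (ℤ × ℤ) × (ℤ × ℤ) × (ℤ × ℤ)} (h : IsSBTriple T)
    (s : List Bool) : 0 < sbCross ((false :: s).foldl sbStep T).2.1 T.2.1 :=
  ((h.step false).foldl_between s).2

/-- Nodes in the right subtree are larger than the node at the top. -/
theorem IsSBTriple.lt_foldl_right {T : (ℤ × ℤ) × (ℤ × ℤ) × (ℤ × ℤ)} (h : IsSBTriple T)
    (s : List Bool) : 0 < sbCross T.2.1 ((true :: s).foldl sbStep T).2.1 :=
  ((h.step true).foldl_between s).1

theorem IsSBTriple.foldl_left_lt_foldl_right {T : (ℤ × ℤ) × (ℤ × ℤ) × (ℤ × ℤ)}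
    (h : IsSBTriple T) (s t : List Bool) :
    0 < sbCross ((false :: s).foldl sbStep T).2.1 ((true :: t).foldl sbStep T).2.1 :=
  sbCross_pos_trans (h.foldl _).den.le h.den (h.foldl _).den.le
    (h.foldl_left_lt s) (h.lt_foldl_right t) (.inl (h.foldl _).den)

theorem sbCross_swap (p q : ℤ × ℤ) : sbCross q p = -sbCross p q := by
  simp only [sbCross]; ring

theorem IsSBTriple.foldl_injective {T : (ℤ × ℤ) × (ℤ × ℤ) × (ℤ × ℤ)} (h : IsSBTriple T)
    {s t : List Bool}
    (hst : sbCross (s.foldl sbStep T).2.1 (t.foldl sbStep T).2.1 = 0) : s = t := by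
  induction s generalizing T t with
  | nil =>
    rcases t with _ | ⟨_ | _, t⟩
    · rfl
    · have := h.foldl_left_lt t
      rw [sbCross_swap] at this
      exact absurd hst (by rw [List.foldl_nil]; lia)
    · exact absurd hst (h.lt_foldl_right t).ne'
  | cons d s ih =>
    rcases t with _ | ⟨e, t⟩
    · cases d
      · exact absurd hst (h.foldl_left_lt s).ne'
      · have := h.lt_foldl_right s
        rw [sbCross_swap] at this
        exact absurd hst (by rw [List.foldl_nil]; lia)
    · by_cases hde : d = e
      · subst hde
        rw [ih (h.step d) hst]
      · cases d <;> cases e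
        · exact absurd rfl hde
        · exact absurd hst (h.foldl_left_lt_foldl_right s t).ne'
        · have := h.foldl_left_lt_foldl_right t s
          rw [sbCross_swap] at this
          lia
        · exact absurd rfl hde

/-- Below a triple whose node is the mediant of its bounds, every fraction strictly between
the bounds is reached. -/
theorem exists_foldl_sbCross_eq_zero (x l r : ℤ × ℤ) (hl : 0 < sbCross l x)
    (hr : 0 < sbCross x r) :
    ∃ s : List Bool, sbCross (s.foldl sbStep (l, mediant l r, r)).2.1 x = 0 := by
  induction hn : (sbCross l x + sbCross x r).toNat using Nat.strong_induction_on
    generalizing l r with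
  | _ n ih =>
    have hm : sbCross (mediant l r) x = sbCross l x - sbCross x r := by
      simp only [sbCross, mediant]; ring
    have hm' := sbCross_swap (mediant l r) x
    rcases lt_trichotomy (sbCross (mediant l r) x) 0 with h | h | h
    · obtain ⟨s, hs⟩ := ih _ (by lia) l (mediant l r) hl (by lia) rfl
      exact ⟨false :: s, hs⟩
    · exact ⟨[], h⟩
    · obtain ⟨s, hs⟩ := ih _ (by lia) (mediant l r) r (by lia) hr rfl
      exact ⟨true :: s, hs⟩

theorem exists_sbNode_sbCross_eq_zero (x : ℤ × ℤ) (hx : 0 < x.2) :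
    ∃ s : List Bool, sbCross (sbNode s) x = 0 := by
  rcases lt_trichotomy x.1 0 with h | h | h
  · obtain ⟨s, hs⟩ := exists_foldl_sbCross_eq_zero x (-1, 0) (0, 1)
      (by simpa [sbCross] using hx) (by simpa [sbCross] using h)
    exact ⟨false :: s, hs⟩
  · exact ⟨[], by simp [sbNode, sbTriple, sbCross, h]⟩
  · obtain ⟨s, hs⟩ := exists_foldl_sbCross_eq_zero x (0, 1) (1, 0)
      (by simpa [sbCross] using h) (by simpa [sbCross] using hx)
    exact ⟨true :: s, hs⟩

theorem sbNode_den_pos (s : List Bool) : 0 < (sbNode s).2 :=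
  (IsSBTriple.root.foldl s).den

theorem div_eq_div_iff_sbCross_eq_zero {p q : ℤ × ℤ} (hp : 0 < p.2) (hq : 0 < q.2) :
    (p.1 : ℚ) / p.2 = q.1 / q.2 ↔ sbCross p q = 0 := by
  rw [div_eq_div_iff (by exact_mod_cast hp.ne') (by exact_mod_cast hq.ne'), sbCross, sub_eq_zero,
    eq_comm, mul_comm p.2]
  norm_cast

/-- the map assigning to each string in `{L,R}*` the rational reached from
the root `0/1` of the Stern–Brocot tree by following the left/right moves is a bijection
onto `ℚ`. -/
theorem sbVal_bijective : Function.Bijective sbVal := by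
  refine ⟨fun s t hst => ?_, fun q => ?_⟩
  · exact IsSBTriple.root.foldl_injective
      ((div_eq_div_iff_sbCross_eq_zero (sbNode_den_pos s) (sbNode_den_pos t)).1 hst)
  · have hq : 0 < (q.num, (q.den : ℤ)).2 := Int.natCast_pos.2 q.pos
    obtain ⟨s, hs⟩ := exists_sbNode_sbCross_eq_zero _ hq
    refine ⟨s, ((div_eq_div_iff_sbCross_eq_zero (sbNode_den_pos s) hq).2 hs).trans ?_⟩
    exact_mod_cast q.num_div_den
end

section
/- If (c1/d1, a/b, c2/d2) belongs to the Stern–Brocot boundary relation B (numerators and denominators as produced by the mediant construction), then a·d1 − c1·b = 1 and c2·b − a·d2 = 1; consequently c1/d1 < a/b < c2/d2 and the fraction a/b is irreducible (gcd(|a|, b) = 1). -/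
theorem SBB.det_left_right {l m r : ℤ × ℤ} (h : SBB l m r) :
    m.1 * l.2 - l.1 * m.2 = 1 ∧ r.1 * m.2 - m.1 * r.2 = 1 := by
  induction h with
  | base => simp
  | left _ ih | right _ ih =>
    obtain ⟨h₁, h₂⟩ := ih
    constructor <;> simp only [mediant] <;> linarith

/-- if `(c1/d1, a/b, c2/d2) ∈ B` then `a·d1 − c1·b = 1` and `c2·b − a·d2 = 1`;
consequently `c1/d1 < a/b < c2/d2` (in cross-multiplied form, valid for the infinite
bounds as well) and `a/b` is irreducible. -/
theorem sbb_determinant (l m r : ℤ × ℤ) (h : SBB l m r) :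
    m.1 * l.2 - l.1 * m.2 = 1 ∧
    r.1 * m.2 - m.1 * r.2 = 1 ∧
    l.1 * m.2 < m.1 * l.2 ∧
    m.1 * r.2 < r.1 * m.2 ∧
    Int.gcd m.1 m.2 = 1 := by
  obtain ⟨h₁, h₂⟩ := h.det_left_right
  refine ⟨h₁, h₂, by linarith, by linarith, ?_⟩
  exact Int.isCoprime_iff_gcd_eq_one.mp ⟨l.2, -l.1, by linarith⟩
end

section
/- Let (p,q) be an edge of the Stern–Brocot tree T_SB with q a child of p. If q = left(p), then every rational r with q < r < p is a descendant of right(q); symmetrically, if q = right(p), then every rational r with p < r < q is a descendant of left(q). In both cases, q is a convergent fraction of every such r. -/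
/-- Every nonempty path is a run-length encoding whose first block has the direction of its head. -/
theorem exists_pathOf_cons (c : Bool) (t : List Bool) :
    ∃ l : List ℕ, (∀ a ∈ l, 0 < a) ∧ c :: t = pathOf c l := by
  induction t generalizing c with
  | nil => exact ⟨[1], by simp, by simp [pathOf]⟩
  | cons d t ih =>
    obtain ⟨l, hl, ht⟩ := ih d
    by_cases h : d = c
    · subst h
      cases l with
      | nil => simp [pathOf] at ht
      | cons a l =>
        refine ⟨(a + 1) :: l, by simpa using fun b hb => hl b (by simp [hb]), ?_⟩
        simp [pathOf, List.replicate_succ, ht]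
    · obtain rfl : d = !c := Bool.eq_not.mpr h
      exact ⟨1 :: l, by simpa using hl, by simp [pathOf, ht]⟩

/-- A path ending just before a change of direction is a convergent of every longer path. -/
theorem convPath_of_turn (s : List Bool) (d : Bool) (u : List Bool) :
    ConvPath (s ++ [d]) ((s ++ [d, !d]) ++ u) := by
  right
  induction s with
  | nil =>
    obtain ⟨l, hl, ht⟩ := exists_pathOf_cons (!d) u
    exact ⟨d, 1 :: l, 1, by simpa using hl, by simp, by simp, by simp [pathOf, ht],
      by simp [pathOf]⟩
  | cons c s ih =>
    obtain ⟨b, l, m, hl, hm, hml, ht, hs⟩ := ih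
    by_cases h : b = c
    · subst h
      obtain ⟨m, rfl⟩ := Nat.exists_eq_add_of_lt hm
      cases l with
      | nil => simp at hml
      | cons a l =>
        refine ⟨b, (a + 1) :: l, m + 1, by simpa using fun b hb => hl b (by simp [hb]),
          by omega, by simpa using hml, ?_, ?_⟩
        · simpa [pathOf, List.replicate_succ] using ht
        · simpa [pathOf, List.replicate_succ] using hs
    · obtain rfl : b = !c := Bool.eq_not.mpr h
      refine ⟨c, 1 :: l, m + 1, by simpa using hl, by omega, by simpa using hml, ?_, ?_⟩
      · simpa [pathOf] using ht
      · simpa [pathOf] using hs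

theorem sbTriple_append (s t : List Bool) : sbTriple (s ++ t) = t.foldl sbStep (sbTriple s) := by
  simp [sbTriple]

/-- The bounds of a node have nonnegative denominators and the node a positive one. -/
theorem sbTriple_denominators (s : List Bool) :
    0 ≤ (sbTriple s).1.2 ∧ 0 < (sbTriple s).2.1.2 ∧ 0 ≤ (sbTriple s).2.2.2 := by
  induction s using List.reverseRecOn with
  | nil => simp [sbTriple]
  | append_singleton s d ih =>
    rw [sbTriple_append]
    rcases h : sbTriple s with ⟨l, m, r⟩
    rw [h] at ih
    cases d <;> simp_all [sbStep, mediant] <;> omega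

/-- Descending from a node that is the mediant of its bounds reaches every fraction strictly
between the bounds. -/
theorem exists_foldl_sbStep_eq (a b : ℤ) (l r : ℤ × ℤ) (hl : 0 ≤ l.2) (hr : 0 ≤ r.2)
    (hm : 0 < l.2 + r.2) (hla : l.1 * b < a * l.2) (har : a * r.2 < r.1 * b) :
    ∃ u : List Bool, (u.foldl sbStep (l, mediant l r, r)).2.1.1 * b =
      a * (u.foldl sbStep (l, mediant l r, r)).2.1.2 := by
  induction h : ((a * l.2 - l.1 * b) + (r.1 * b - a * r.2)).toNat using Nat.strong_induction_on
    generalizing l r with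
  | _ n ih =>
    rcases lt_trichotomy (a * (l.2 + r.2)) ((l.1 + r.1) * b) with hlt | heq | hgt
    · obtain ⟨u, hu⟩ := ih _ (by rw [← h, mediant]; dsimp only; ring_nf at *; omega)
        l (mediant l r) hl hm.le (by simp only [mediant]; omega) hla hlt rfl
      exact ⟨false :: u, hu⟩
    · exact ⟨[], heq.symm⟩
    · obtain ⟨u, hu⟩ := ih _ (by rw [← h, mediant]; dsimp only; ring_nf at *; omega)
        (mediant l r) r hm.le hr (by simp only [mediant]; omega) hgt har rfl
      exact ⟨true :: u, hu⟩

/-- Every rational strictly between two bounds with positive denominators is the value of a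
node below the path whose node is their mediant. -/
theorem exists_sbVal_append_eq (s : List Bool) (l r : ℤ × ℤ) (hl : 0 < l.2) (hr : 0 < r.2)
    (hs : sbTriple s = (l, mediant l r, r)) (x : ℚ) (hlx : (l.1 : ℚ) / l.2 < x)
    (hxr : x < (r.1 : ℚ) / r.2) : ∃ u : List Bool, sbVal (s ++ u) = x := by
  have hd : (0 : ℚ) < x.den := by exact_mod_cast x.den_pos
  have hl' : (0 : ℚ) < l.2 := by exact_mod_cast hl
  have hr' : (0 : ℚ) < r.2 := by exact_mod_cast hr
  rw [← Rat.num_div_den x] at hlx hxr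
  rw [div_lt_div_iff₀ hl' hd] at hlx
  rw [div_lt_div_iff₀ hd hr'] at hxr
  obtain ⟨u, hu⟩ := exists_foldl_sbStep_eq x.num x.den l r hl.le hr.le (by omega)
    (by exact_mod_cast hlx) (by exact_mod_cast hxr)
  refine ⟨u, ?_⟩
  rw [← hs, ← sbTriple_append] at hu
  have hpos : (0 : ℚ) < (sbTriple (s ++ u)).2.1.2 := by
    exact_mod_cast (sbTriple_denominators (s ++ u)).2.1
  rw [sbVal, sbNode, ← Rat.num_div_den x, div_eq_div_iff hpos.ne' hd.ne']
  exact_mod_cast hu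

/-- let `(p, q)` be an edge of the Stern–Brocot tree with `q` a child of the
node `p` at path `s`. If `q = left(p)` then every rational `r` with `q < r < p` lies in
the subtree rooted at `right(q)`, and symmetrically for `q = right(p)`; in both cases
`q` is a convergent fraction of every such `r`. (`false` = L, `true` = R.) -/
theorem edge_interval_descendants (s : List Bool) (p q : ℚ) (hp : sbVal s = p) :
    (sbVal (s ++ [false]) = q →
      ∀ r : ℚ, q < r → r < p →
        ∃ u : List Bool, sbVal ((s ++ [false, true]) ++ u) = r ∧
          ConvPath (s ++ [false]) ((s ++ [false, true]) ++ u)) ∧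
    (sbVal (s ++ [true]) = q →
      ∀ r : ℚ, p < r → r < q →
        ∃ u : List Bool, sbVal ((s ++ [true, false]) ++ u) = r ∧
          ConvPath (s ++ [true]) ((s ++ [true, false]) ++ u)) := by
  subst hp
  obtain ⟨h1, h2, h3⟩ := sbTriple_denominators s
  rcases h : sbTriple s with ⟨l, m, r⟩
  rw [h] at h1 h2 h3
  dsimp only at h1 h2 h3
  constructor
  · rintro rfl x hqx hxp
    obtain ⟨u, hu⟩ := exists_sbVal_append_eq (s ++ [false, true]) (mediant l m) m
      (by simp only [mediant]; omega) h2 (by simp [sbTriple_append, h, sbStep]) x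
      (by simpa [sbVal, sbNode, sbTriple_append, h, sbStep] using hqx)
      (by simpa [sbVal, sbNode, h] using hxp)
    exact ⟨u, hu, convPath_of_turn s false u⟩
  · rintro rfl x hpx hxq
    obtain ⟨u, hu⟩ := exists_sbVal_append_eq (s ++ [true, false]) m (mediant m r)
      h2 (by simp only [mediant]; omega) (by simp [sbTriple_append, h, sbStep]) x
      (by simpa [sbVal, sbNode, h] using hpx)
      (by simpa [sbVal, sbNode, sbTriple_append, h, sbStep] using hxq)
    exact ⟨u, hu, convPath_of_turn s true u⟩
end

section
/- Let q ∈ ℚ be a vertex of the Stern–Brocot tree whose path from the root, in run-length form, is R^{a1}L^{a2}⋯D^{an} with D ∈ {L,R} and all ai ≥ 1. Then q = a1 + 1/(a2 + 1/(a3 + ⋯ + 1/(a_{n−1} + 1/(an + 1)))) − 1 (the finite continued fraction with partial quotients a1, a2, …, a_{n−1}, an+1, minus 1). Symmetrically, if the path is L^{a1}R^{a2}⋯D^{an}, then q = −(a1 + 1/(a2 + 1/(⋯ + 1/(an + 1))) − 1). In particular, if the path is R^{a1} then q = a1, and if it is L^{a1} then q = −a1. -/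
theorem cfval_cons (a : ℕ) (l : List ℕ) : cfval (a :: l) = a + 1 / cfval l := by
  cases l <;> simp [cfval]

/-- The boundary triple of the mediant of `u` and `v`, where `v` is the bound on side `b`. -/
def mediantTriple (b : Bool) (u v : ℤ × ℤ) : (ℤ × ℤ) × (ℤ × ℤ) × (ℤ × ℤ) :=
  if b then (u, u + v, v) else (v, u + v, u)

theorem mediantTriple_not (b : Bool) (u v : ℤ × ℤ) :
    mediantTriple (!b) u v = mediantTriple b v u := by
  cases b <;> simp [mediantTriple, add_comm]

theorem sbStep_mediantTriple (b : Bool) (u v : ℤ × ℤ) :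
    sbStep (mediantTriple b u v) b = mediantTriple b (u + v) v := by
  cases b <;> simp [mediantTriple, sbStep, mediant, Prod.ext_iff, add_comm]

theorem foldl_sbStep_replicate (b : Bool) (a : ℕ) (u v : ℤ × ℤ) :
    (List.replicate a b).foldl sbStep (mediantTriple b u v) =
      mediantTriple b (u + a • v) v := by
  induction a generalizing u with
  | zero => simp
  | succ a ih =>
    rw [List.replicate_succ, List.foldl_cons, sbStep_mediantTriple, ih, succ_nsmul', add_assoc]

/-- Following a path from the mediant of `u` and `v` leads to `q • u + p • v`, where `p / q` is
the continued fraction of the path. -/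
theorem exists_foldl_sbStep_pathOf (l : List ℕ) :
    ∃ p q : ℕ, 0 < p ∧ 0 < q ∧ cfval l = p / q ∧ ∀ (b : Bool) (u v : ℤ × ℤ),
      ((pathOf b l).foldl sbStep (mediantTriple b u v)).2.1 = q • u + p • v := by
  induction l with
  | nil =>
    refine ⟨1, 1, one_pos, one_pos, by simp [cfval], fun b u v => ?_⟩
    cases b <;> simp [pathOf, mediantTriple]
  | cons a l ih =>
    obtain ⟨p, q, hp, hq, hval, hnode⟩ := ih
    refine ⟨a * p + q, p, by positivity, hp, ?_, fun b u v => ?_⟩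
    · rw [cfval_cons, hval]
      push_cast
      field_simp
    · rw [pathOf, List.foldl_append, foldl_sbStep_replicate, ← mediantTriple_not, hnode]
      module

theorem sbVal_pathOf (l : List ℕ) (hl : l ≠ []) (hpos : ∀ a ∈ l, 0 < a) :
    sbVal (pathOf true l) = cfval l - 1 ∧ sbVal (pathOf false l) = -(cfval l - 1) := by
  obtain _ | ⟨a, l⟩ := l
  · exact absurd rfl hl
  obtain ⟨a, rfl⟩ := Nat.exists_eq_add_one.mpr (hpos a List.mem_cons_self)
  obtain ⟨p, q, -, -, hval, hnode⟩ := exists_foldl_sbStep_pathOf (a :: l)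
  have hcf : cfval ((a + 1) :: l) - 1 = p / q := by
    rw [← hval, cfval_cons, cfval_cons]
    push_cast
    ring
  have htrue : sbNode (pathOf true ((a + 1) :: l)) = ((p : ℤ), (q : ℤ)) := by
    have h := hnode true (0, 1) (1, 0)
    simp only [Prod.smul_mk, Prod.mk_add_mk, nsmul_eq_mul, mul_zero, mul_one, zero_add,
      add_zero] at h
    exact h
  have hfalse : sbNode (pathOf false ((a + 1) :: l)) = (-(p : ℤ), (q : ℤ)) := by
    have h := hnode false (0, 1) (-1, 0)
    simp only [Prod.smul_mk, Prod.mk_add_mk, nsmul_eq_mul, mul_zero, mul_one, mul_neg, zero_add,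
      add_zero] at h
    exact h
  rw [hcf, sbVal, sbVal, htrue, hfalse]
  simp [neg_div]

/-- if the path from the root to `q` is `R^{a1}L^{a2}⋯D^{an}` (all `ai ≥ 1`)
then `q = a1 + 1/(a2 + ⋯ + 1/(an + 1)) - 1`, and if it is `L^{a1}R^{a2}⋯D^{an}` then
`q` is the negative of that value. In particular `R^{a1}` gives `a1` and `L^{a1}`
gives `-a1`. (`false` = L, `true` = R.) -/
theorem sbVal_continued_fraction (l : List ℕ) (hl : l ≠ []) (hpos : ∀ a ∈ l, 0 < a) :
    sbVal (pathOf true l) = cfval l - 1 ∧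
    sbVal (pathOf false l) = -(cfval l - 1) ∧
    (∀ a : ℕ, 0 < a →
      sbVal (List.replicate a true) = (a : ℚ) ∧
      sbVal (List.replicate a false) = -(a : ℚ)) := by
  obtain ⟨htrue, hfalse⟩ := sbVal_pathOf l hl hpos
  refine ⟨htrue, hfalse, fun a ha => ?_⟩
  simpa [pathOf, cfval] using sbVal_pathOf [a] (by simp) (by simpa using ha)
end

section
/- (Proposition 1, precise form.) Let q be a nonzero rational with SB-encoding ∼[a1,…,an], and write |q| + 1 = c/d as an irreducible fraction. Then Σ_{i=1}^{n} log₂(ai) ≤ log₂(c) + log₂(d); equivalently, a1·a2·⋯·an ≤ c·d. In particular Σ_{i=1}^{n} log₂(ai) ∈ O(size(q)), where size(a/b) = log₂|a| + log₂ b for an irreducible fraction a/b with a ≠ 0. -/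
/-- Moving `a + 1` times to the right. -/
theorem foldl_sbStep_replicate_true (a : ℕ) (l m r : ℤ × ℤ) :
    (List.replicate (a + 1) true).foldl sbStep (l, m, r) =
      ((m.1 + a * r.1, m.2 + a * r.2), (m.1 + (a + 1) * r.1, m.2 + (a + 1) * r.2), r) := by
  induction a generalizing l m with
  | zero => simp [sbStep, mediant]
  | succ a ih =>
    rw [List.replicate_succ, List.foldl_cons]
    simp only [sbStep, ih, mediant, Prod.mk.injEq]
    push_cast
    refine ⟨⟨?_, ?_⟩, ⟨?_, ?_⟩, trivial⟩ <;> ring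

/-- Moving `a + 1` times to the left. -/
theorem foldl_sbStep_replicate_false (a : ℕ) (l m r : ℤ × ℤ) :
    (List.replicate (a + 1) false).foldl sbStep (l, m, r) =
      (l, (m.1 + (a + 1) * l.1, m.2 + (a + 1) * l.2), (m.1 + a * l.1, m.2 + a * l.2)) := by
  induction a generalizing m r with
  | zero => simp [sbStep, mediant, add_comm]
  | succ a ih =>
    rw [List.replicate_succ, List.foldl_cons]
    simp only [sbStep, ih, mediant, Prod.mk.injEq]
    push_cast
    refine ⟨trivial, ⟨?_, ?_⟩, ?_, ?_⟩ <;> ring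

/-- The invariant relating a node `m`, the bound `x` towards which the next block moves, and the
product `P` of the lengths of the blocks read so far. -/
structure BlockBound (P : ℤ) (m x : ℤ × ℤ) : Prop where
  num_nonneg : 0 ≤ m.1
  den_pos : 0 < m.2
  bound_num_nonneg : 0 ≤ x.1
  bound_den_nonneg : 0 ≤ x.2
  le_node : P ≤ (m.1 + m.2) * m.2
  le_cross : P ≤ (x.1 + x.2) * m.2 + (m.1 + m.2) * x.2

theorem BlockBound.next {P : ℤ} {m x : ℤ × ℤ} (hP : 0 ≤ P) (h : BlockBound P m x) (a : ℕ) :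
    BlockBound (P * (a + 1)) (m.1 + (a + 1) * x.1, m.2 + (a + 1) * x.2)
      (m.1 + a * x.1, m.2 + a * x.2) := by
  obtain ⟨h1, h2, h3, h4, h5, h6⟩ := h
  have ha : (0 : ℤ) ≤ a := Int.natCast_nonneg a
  have hx : 0 ≤ (x.1 + x.2) * x.2 := by positivity
  have haC := mul_le_mul_of_nonneg_left h6 ha
  have haP := mul_nonneg ha hP
  have haX := mul_nonneg ha hx
  have haaX := mul_nonneg ha haX
  refine ⟨by positivity, by positivity, by positivity, by positivity, ?_, ?_⟩ <;>
    dsimp only <;> nlinarith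

theorem foldl_sbStep_pathOf_bound (l : List ℕ) (hpos : ∀ a ∈ l, 0 < a) (b : Bool) (P : ℤ)
    (hP : 0 ≤ P) (t : (ℤ × ℤ) × (ℤ × ℤ) × (ℤ × ℤ))
    (h : BlockBound P t.2.1 (if b then t.2.2 else t.1)) :
    ∃ x, BlockBound (P * l.prod) ((pathOf b l).foldl sbStep t).2.1 x := by
  induction l generalizing b P t with
  | nil => exact ⟨_, by simpa [pathOf] using h⟩
  | cons a l ih =>
    obtain ⟨k, rfl⟩ : ∃ k, a = k + 1 := Nat.exists_eq_add_one.2 (hpos a (by simp))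
    have hl : ∀ a ∈ l, 0 < a := fun c hc => hpos c (by simp [hc])
    obtain ⟨u, m, r⟩ := t
    have hn := h.next hP k
    have hP' : 0 ≤ P * ((k : ℤ) + 1) := by positivity
    rw [List.prod_cons, Nat.cast_mul, ← mul_assoc, Nat.cast_add_one, pathOf, List.foldl_append]
    cases b
    · rw [foldl_sbStep_replicate_false]
      exact ih hl true _ hP' (_, _, _) hn
    · rw [foldl_sbStep_replicate_true]
      exact ih hl false _ hP' (_, _, _) hn

theorem foldl_sbStep_det (s : List Bool) (t : (ℤ × ℤ) × (ℤ × ℤ) × (ℤ × ℤ))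
    (h : t.2.1.1 * t.1.2 - t.1.1 * t.2.1.2 = 1 ∧ t.2.2.1 * t.2.1.2 - t.2.1.1 * t.2.2.2 = 1) :
    (s.foldl sbStep t).2.1.1 * (s.foldl sbStep t).1.2
      - (s.foldl sbStep t).1.1 * (s.foldl sbStep t).2.1.2 = 1 := by
  induction s generalizing t with
  | nil => exact h.1
  | cons d s ih =>
    obtain ⟨l, m, r⟩ := t
    refine ih _ ?_
    cases d <;> simp only [sbStep, mediant] at h ⊢ <;> constructor <;> linarith [h.1, h.2]

theorem isCoprime_sbNode (s : List Bool) : IsCoprime (sbNode s).1 (sbNode s).2 := by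
  have h := foldl_sbStep_det s ((-1, 0), (0, 1), (1, 0)) (by simp)
  exact ⟨(sbTriple s).1.2, -(sbTriple s).1.1, by unfold sbNode sbTriple; linarith⟩

/-- Reflection of a boundary triple at zero. -/
def sbMirror (t : (ℤ × ℤ) × (ℤ × ℤ) × (ℤ × ℤ)) : (ℤ × ℤ) × (ℤ × ℤ) × (ℤ × ℤ) :=
  ((-t.2.2.1, t.2.2.2), (-t.2.1.1, t.2.1.2), (-t.1.1, t.1.2))

theorem foldl_sbStep_map_not (s : List Bool) (t : (ℤ × ℤ) × (ℤ × ℤ) × (ℤ × ℤ)) :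
    (s.map not).foldl sbStep (sbMirror t) = sbMirror (s.foldl sbStep t) := by
  induction s generalizing t with
  | nil => rfl
  | cons d s ih =>
    rw [List.map_cons, List.foldl_cons, List.foldl_cons, ← ih]
    congr 1
    obtain ⟨l, m, r⟩ := t
    cases d <;> simp [sbStep, sbMirror, mediant, add_comm]

theorem pathOf_not (b : Bool) (l : List ℕ) : pathOf (!b) l = (pathOf b l).map not := by
  induction l generalizing b with
  | nil => rfl
  | cons a l ih => simp [pathOf, ← ih]

theorem sbVal_map_not (s : List Bool) : sbVal (s.map not) = -sbVal s := by
  have h : sbTriple (s.map not) = sbMirror (sbTriple s) := by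
    simpa [sbTriple, sbMirror] using foldl_sbStep_map_not s ((-1, 0), (0, 1), (1, 0))
  simp [sbVal, sbNode, h, sbMirror, neg_div]

theorem abs_sbVal_pathOf (b : Bool) (l : List ℕ) :
    |sbVal (pathOf b l)| = |sbVal (pathOf true l)| := by
  cases b
  · rw [← Bool.not_true, pathOf_not, sbVal_map_not, abs_neg]
  · rfl

/-- Proposition 1, precise form: if the nonzero rational `q` has
SB-encoding `∼[a1,…,an]` and `|q| + 1 = c/d` is irreducible, then
`a1·a2·⋯·an ≤ c·d` (equivalently `Σ log₂ ai ≤ log₂ c + log₂ d`). -/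
theorem sum_log_SB_encoding_le (b : Bool) (l : List ℕ) (hl : l ≠ [])
    (hpos : ∀ a ∈ l, 0 < a) :
    (l.prod : ℤ) ≤
      (|sbVal (pathOf b l)| + 1).num * ((|sbVal (pathOf b l)| + 1).den : ℤ) := by
  rw [abs_sbVal_pathOf]
  obtain ⟨x, h⟩ := foldl_sbStep_pathOf_bound l hpos true 1 zero_le_one
    ((-1, 0), (0, 1), (1, 0)) ⟨by simp, by simp, by simp, by simp, by simp, by simp⟩
  have hnum : 0 ≤ (sbNode (pathOf true l)).1 := h.num_nonneg
  have hden : 0 < (sbNode (pathOf true l)).2 := h.den_pos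
  have hle : 1 * (l.prod : ℤ) ≤ ((sbNode (pathOf true l)).1 + (sbNode (pathOf true l)).2) *
    (sbNode (pathOf true l)).2 := h.le_node
  have hcop := isCoprime_sbNode (pathOf true l)
  unfold sbVal
  generalize sbNode (pathOf true l) = n at *
  have hcop' : Nat.Coprime (n.1 + n.2).natAbs n.2.natAbs := by
    rw [← Int.isCoprime_iff_nat_coprime]
    simpa using hcop.add_mul_left_left 1
  have hval : |(n.1 : ℚ) / n.2| + 1 = ((n.1 + n.2 : ℤ) : ℚ) / n.2 := by
    have h1 : (0 : ℚ) ≤ n.1 := by exact_mod_cast hnum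
    have h2 : (0 : ℚ) < n.2 := by exact_mod_cast hden
    rw [abs_of_nonneg (by positivity)]
    push_cast
    field_simp
  rw [hval, Rat.num_div_eq_of_coprime hden hcop', Rat.den_div_eq_of_coprime hden hcop']
  linarith
end

section
/- (Proposition 3, part 2.) Let γ: ℚ → Σ be a finite piecewise function and let D = (q1,A1),…,(qm,Am) with q1 < q2 < ⋯ < qm, γ(qi) = Ai for all i, and suppose that for every break link (p,q) of γ both p and q belong to {q1,…,qm}. Then for every i, qi is a right-bound of γ if and only if i ≤ m−1, qi is an ancestor of q_{i+1} in the Stern–Brocot tree, and Ai ≠ A_{i+1}. -/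
/-- The rational number at the node of a Stern–Brocot state. -/
def stateVal (T : (ℤ × ℤ) × (ℤ × ℤ) × (ℤ × ℤ)) : ℚ := (T.2.1.1 : ℚ) / (T.2.1.2 : ℚ)

/-- The invariant of the states occurring in the Stern–Brocot tree. -/
structure IsSBState (T : (ℤ × ℤ) × (ℤ × ℤ) × (ℤ × ℤ)) : Prop where
  left_det : T.2.1.1 * T.1.2 - T.1.1 * T.2.1.2 = 1
  right_det : T.2.2.1 * T.2.1.2 - T.2.1.1 * T.2.2.2 = 1
  left_nonneg : 0 ≤ T.1.2
  right_nonneg : 0 ≤ T.2.2.2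
  den_pos : 0 < T.2.1.2

namespace IsSBState

variable {T : (ℤ × ℤ) × (ℤ × ℤ) × (ℤ × ℤ)}

theorem step (h : IsSBState T) (b : Bool) : IsSBState (sbStep T b) := by
  obtain ⟨⟨a, b'⟩, ⟨c, d⟩, ⟨e, f⟩⟩ := T
  obtain ⟨h1, h2, h3, h4, h5⟩ := h
  dsimp only at *
  cases b <;> constructor <;> simp only [sbStep, mediant] <;> first | omega | linarith

theorem foldl (h : IsSBState T) (t : List Bool) : IsSBState (t.foldl sbStep T) := by
  induction t generalizing T with
  | nil => exact h
  | cons b t ih => exact ih (h.step b)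

theorem of_sbTriple (s : List Bool) : IsSBState (sbTriple s) :=
  foldl (by constructor <;> norm_num) s

theorem den_pos_rat (h : IsSBState T) : (0 : ℚ) < T.2.1.2 := by exact_mod_cast h.den_pos

theorem lt_stateVal_iff (h : IsSBState T) {y : ℚ} : y < stateVal T ↔ y * T.2.1.2 < T.2.1.1 :=
  lt_div_iff₀ h.den_pos_rat

theorem stateVal_lt_iff (h : IsSBState T) {y : ℚ} : stateVal T < y ↔ (T.2.1.1 : ℚ) < y * T.2.1.2 :=
  div_lt_iff₀ h.den_pos_rat

/-- Every node of a subtree lies strictly between the boundaries of the root of the subtree. -/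
theorem foldl_between (h : IsSBState T) (t : List Bool) :
    (T.1.1 : ℚ) < stateVal (t.foldl sbStep T) * T.1.2 ∧
      stateVal (t.foldl sbStep T) * T.2.2.2 < T.2.2.1 := by
  induction t generalizing T with
  | nil =>
    have hd := h.den_pos_rat
    have h1 : (T.2.1.1 : ℚ) * T.1.2 - T.1.1 * T.2.1.2 = 1 := by exact_mod_cast h.left_det
    have h2 : (T.2.2.1 : ℚ) * T.2.1.2 - T.2.1.1 * T.2.2.2 = 1 := by exact_mod_cast h.right_det
    simp only [List.foldl_nil, stateVal]
    rw [div_mul_eq_mul_div, div_mul_eq_mul_div, lt_div_iff₀ hd, div_lt_iff₀ hd]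
    constructor <;> linarith
  | cons b t ih =>
    have hd := h.den_pos_rat
    have h1 : (T.2.1.1 : ℚ) * T.1.2 - T.1.1 * T.2.1.2 = 1 := by exact_mod_cast h.left_det
    have h2 : (T.2.2.1 : ℚ) * T.2.1.2 - T.2.1.1 * T.2.2.2 = 1 := by exact_mod_cast h.right_det
    have hl0 : (0 : ℚ) ≤ T.1.2 := by exact_mod_cast h.left_nonneg
    have hr0 : (0 : ℚ) ≤ T.2.2.2 := by exact_mod_cast h.right_nonneg
    obtain ⟨hl, hr⟩ := ih (h.step b)
    rw [List.foldl_cons]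
    generalize stateVal (t.foldl sbStep (sbStep T b)) = v at hl hr ⊢
    cases b
    · simp only [sbStep] at hl hr
      exact ⟨hl, lt_of_mul_lt_mul_right (by nlinarith) hd.le⟩
    · simp only [sbStep] at hl hr
      exact ⟨lt_of_mul_lt_mul_right (by nlinarith) hd.le, hr⟩

theorem foldl_false_lt (h : IsSBState T) (t : List Bool) :
    stateVal ((false :: t).foldl sbStep T) < stateVal T :=
  h.lt_stateVal_iff.2 ((h.step false).foldl_between t).2

theorem lt_foldl_true (h : IsSBState T) (t : List Bool) :
    stateVal T < stateVal ((true :: t).foldl sbStep T) :=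
  h.stateVal_lt_iff.2 ((h.step true).foldl_between t).1

/-- Every rational strictly between the boundaries of a node lies in the subtree of that node. -/
theorem exists_foldl_eq (h : IsSBState T) (hm : T.2.1 = mediant T.1 T.2.2) {y : ℚ}
    (hl : (T.1.1 : ℚ) < y * T.1.2) (hr : y * T.2.2.2 < T.2.2.1) :
    ∃ t : List Bool, stateVal (t.foldl sbStep T) = y := by
  have hy : (0 : ℚ) < y.den := by exact_mod_cast y.den_pos
  have cross (a b : ℤ) : ((y.num * b - a * y.den : ℤ) : ℚ) = (y * b - a) * y.den := by
    push_cast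
    rw [sub_mul, mul_right_comm, Rat.mul_den_eq_num]
  have cross_pos (a b : ℤ) (hab : (a : ℚ) < y * b) : 0 < y.num * b - a * y.den := by
    have : (0 : ℚ) < ((y.num * b - a * y.den : ℤ) : ℚ) := by
      rw [cross]; exact mul_pos (sub_pos.2 hab) hy
    exact_mod_cast this
  have cross_neg (a b : ℤ) (hab : y * b < (a : ℚ)) : y.num * b - a * y.den < 0 := by
    have : ((y.num * b - a * y.den : ℤ) : ℚ) < 0 := by
      rw [cross]; exact mul_neg_of_neg_of_pos (sub_neg.2 hab) hy
    exact_mod_cast this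
  obtain ⟨n, hn⟩ : ∃ n : ℕ, (y.num * T.1.2 - T.1.1 * y.den) -
      (y.num * T.2.2.2 - T.2.2.1 * y.den) ≤ n := ⟨_, Int.self_le_toNat _⟩
  induction n generalizing T with
  | zero =>
    have := cross_pos _ _ hl
    have := cross_neg _ _ hr
    push_cast at hn
    omega
  | succ n ih =>
    have hL := cross_pos _ _ hl
    have hR := cross_neg _ _ hr
    have h1 : T.2.1.1 = T.1.1 + T.2.2.1 := congrArg Prod.fst hm
    have h2 : T.2.1.2 = T.1.2 + T.2.2.2 := congrArg Prod.snd hm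
    rcases lt_trichotomy (stateVal T) y with hlt | heq | hgt
    · have hy' := h.stateVal_lt_iff.1 hlt
      obtain ⟨t, ht⟩ := ih (h.step true) rfl hy' hr (by
        simp only [sbStep]
        rw [h1, h2]
        push_cast at hn
        linarith)
      exact ⟨true :: t, ht⟩
    · exact ⟨[], heq⟩
    · have hy' := h.lt_stateVal_iff.1 hgt
      obtain ⟨t, ht⟩ := ih (h.step false) rfl hl hy' (by
        simp only [sbStep]
        rw [h1, h2]
        push_cast at hn
        linarith)
      exact ⟨false :: t, ht⟩

end IsSBState

theorem foldl_replicate_false (T : (ℤ × ℤ) × (ℤ × ℤ) × (ℤ × ℤ)) (k : ℕ) :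
    ((List.replicate k false).foldl sbStep T).1 = T.1 ∧
      ((List.replicate k false).foldl sbStep T).2.1 =
        (T.2.1.1 + k * T.1.1, T.2.1.2 + k * T.1.2) := by
  induction k with
  | zero => simp
  | succ k ih =>
    rw [List.replicate_succ', List.foldl_append]
    simp only [List.foldl_cons, List.foldl_nil, sbStep, mediant, ih.1, ih.2, true_and]
    ext <;> push_cast <;> ring

theorem foldl_replicate_true (T : (ℤ × ℤ) × (ℤ × ℤ) × (ℤ × ℤ)) (k : ℕ) :
    ((List.replicate k true).foldl sbStep T).2.2 = T.2.2 ∧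
      ((List.replicate k true).foldl sbStep T).2.1 =
        (T.2.1.1 + k * T.2.2.1, T.2.1.2 + k * T.2.2.2) := by
  induction k with
  | zero => simp
  | succ k ih =>
    rw [List.replicate_succ', List.foldl_append]
    simp only [List.foldl_cons, List.foldl_nil, sbStep, mediant, ih.1, ih.2, true_and]
    ext <;> push_cast <;> ring

theorem sbVal_append (s t : List Bool) :
    sbVal (s ++ t) = stateVal (t.foldl sbStep (sbTriple s)) := by
  simp only [sbVal, sbNode, stateVal, sbTriple, List.foldl_append]

theorem sbVal_lt_sbVal_append_true (s t : List Bool) : sbVal s < sbVal (s ++ true :: t) := by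
  rw [sbVal_append]
  exact (IsSBState.of_sbTriple s).lt_foldl_true t

theorem sbVal_append_false_lt (s : List Bool) : sbVal (s ++ [false]) < sbVal s := by
  rw [sbVal_append]
  exact (IsSBState.of_sbTriple s).foldl_false_lt []

theorem exists_sbVal_eq (y : ℚ) : ∃ s, sbVal s = y := by
  have h := IsSBState.of_sbTriple []
  rcases lt_trichotomy y 0 with hy | rfl | hy
  · obtain ⟨t, ht⟩ := (h.step false).exists_foldl_eq rfl (y := y)
      (by simp [sbTriple, sbStep]) (by simpa [sbTriple, sbStep] using hy)
    exact ⟨false :: t, ht⟩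
  · exact ⟨[], by simp [sbVal, sbNode, sbTriple]⟩
  · obtain ⟨t, ht⟩ := (h.step true).exists_foldl_eq rfl (y := y)
      (by simpa [sbTriple, sbStep] using hy) (by simp [sbTriple, sbStep])
    exact ⟨true :: t, ht⟩

theorem isAncestor_of_le_right_child {s : List Bool} {y : ℚ} (hl : sbVal s < y)
    (hr : y ≤ sbVal (s ++ [true])) : IsAncestor (sbVal s) y := by
  have h := IsSBState.of_sbTriple s
  have hb := ((h.step true).foldl_between []).2
  rw [sbVal_append] at hr
  obtain ⟨t, ht⟩ := (h.step true).exists_foldl_eq rfl (y := y) (h.stateVal_lt_iff.1 hl)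
    ((mul_le_mul_of_nonneg_right hr (by exact_mod_cast (h.step true).right_nonneg)).trans_lt hb)
  exact ⟨s, true :: t, rfl, by simp, by rw [sbVal_append]; exact ht⟩

/-- The descendants `s R L^k` converge to `s` from the right. -/
theorem exists_sbVal_append_false_lt {s : List Bool} {u : ℚ} (hu : sbVal s < u) :
    ∃ k, sbVal (s ++ true :: List.replicate k false) < u := by
  have h := (IsSBState.of_sbTriple s).step true
  have hc := (IsSBState.of_sbTriple s).stateVal_lt_iff.1 hu
  obtain ⟨k, hk⟩ := exists_lt_nsmul (sub_pos.2 hc)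
    (((sbStep (sbTriple s) true).2.1.1 : ℚ) - u * (sbStep (sbTriple s) true).2.1.2)
  refine ⟨k, ?_⟩
  rw [sbVal_append, List.foldl_cons, (h.foldl _).stateVal_lt_iff, (foldl_replicate_false _ k).2]
  rw [nsmul_eq_mul] at hk
  have e : (sbStep (sbTriple s) true).1 = (sbTriple s).2.1 := rfl
  push_cast
  rw [e]
  linarith

/-- The descendants `s R^k` eventually exceed every number below the right boundary of `s`. -/
theorem exists_lt_sbVal_append_true {s : List Bool} {y : ℚ}
    (hy : y * (sbTriple s).2.2.2 < (sbTriple s).2.2.1) :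
    ∃ k, y < sbVal (s ++ List.replicate k true) := by
  have h := IsSBState.of_sbTriple s
  obtain ⟨k, hk⟩ := exists_lt_nsmul (sub_pos.2 hy)
    (y * (sbTriple s).2.1.2 - ((sbTriple s).2.1.1 : ℚ))
  refine ⟨k, ?_⟩
  rw [sbVal_append, (h.foldl _).lt_stateVal_iff, (foldl_replicate_true _ k).2]
  rw [nsmul_eq_mul] at hk
  push_cast
  linarith

section Partition

variable {S : Type*} {γ : ℚ → S}

/-- Merging two adjacent intervals of an interval partition. -/
theorem IsIntervalPartition.merge {L M : List (Set ℚ)} {I J : Set ℚ}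
    (h : IsIntervalPartition (L ++ I :: J :: M)) : IsIntervalPartition (L ++ (I ∪ J) :: M) := by
  obtain ⟨h1, h2, h3⟩ := h
  simp only [List.mem_append, List.mem_cons, List.pairwise_append, List.pairwise_cons] at h1 h2 h3
  obtain ⟨hL, ⟨hI, hJ, hM⟩, hLM⟩ := h2
  refine ⟨?_, ?_, ?_⟩
  · intro K hK
    simp only [List.mem_append, List.mem_cons] at hK
    rcases hK with hK | rfl | hK
    · exact h1 K (Or.inl hK)
    · have iI := h1 I (by simp)
      have iJ := h1 J (by simp)
      refine ⟨iI.1.inl, fun p hp q hq r hpr hrq => ?_⟩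
      obtain ⟨K, hK, hrK⟩ := h3 r
      rcases hK with hK | rfl | rfl | hK
      · have hp' : r < p := hp.elim (hLM K hK I (by simp) r hrK p)
          (hLM K hK J (by simp) r hrK p)
        exact absurd hpr hp'.not_gt
      · exact Or.inl hrK
      · exact Or.inr hrK
      · have hq' : q < r := hq.elim (fun hq => hI K (Or.inr hK) q hq r hrK)
          (fun hq => hJ K hK q hq r hrK)
        exact absurd hrq hq'.not_gt
    · exact h1 K (by simp [hK])
  · simp only [List.mem_cons, List.pairwise_append, List.pairwise_cons]
    refine ⟨hL, ⟨fun K hK p hp q hq => ?_, hM⟩, fun K hK K' hK' p hp q hq => ?_⟩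
    · exact hp.elim (fun hp => hI K (Or.inr hK) p hp q hq) (fun hp => hJ K hK p hp q hq)
    · rcases hK' with rfl | hK'
      · exact hq.elim (hLM K hK I (by simp) p hp q) (hLM K hK J (by simp) p hp q)
      · exact hLM K hK K' (by simp [hK']) p hp q hq
  · intro x
    obtain ⟨K, hK, hx⟩ := h3 x
    simp only [List.mem_append, List.mem_cons]
    rcases hK with hK | rfl | rfl | hK
    · exact ⟨K, Or.inl hK, hx⟩
    · exact ⟨_, Or.inr (Or.inl rfl), Or.inl hx⟩
    · exact ⟨_, Or.inr (Or.inl rfl), Or.inr hx⟩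
    · exact ⟨K, Or.inr (Or.inr hK), hx⟩

theorem FinitePW.exists_isCanonicalRep (hγ : FinitePW γ) : ∃ P, IsCanonicalRep γ P := by
  obtain ⟨P, hP, hm⟩ := hγ
  induction hn : P.length using Nat.strong_induction_on generalizing P with
  | _ n ih =>
    by_cases hc : P.IsChain (fun I J => ∀ p ∈ I, ∀ q ∈ J, γ p ≠ γ q)
    · exact ⟨P, hP, hm, hc⟩
    · rw [List.isChain_iff_forall_rel_of_append_cons_cons] at hc
      push Not at hc
      obtain ⟨I, J, L, M, rfl, p, hp, q, hq, hpq⟩ := hc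
      refine ih _ ?_ (L ++ (I ∪ J) :: M) hP.merge ?_ rfl
      · simp only [← hn, List.length_append, List.length_cons]
        omega
      · intro K hK
        simp only [List.mem_append, List.mem_cons] at hK
        rcases hK with hK | rfl | hK
        · exact hm K (by simp [hK])
        · have hIp : ∀ a ∈ I ∪ J, γ a = γ p := by
            rintro a (ha | ha)
            · exact hm I (by simp) a ha p hp
            · exact (hm J (by simp) a ha q hq).trans hpq.symm
          exact fun a ha b hb => (hIp a ha).trans (hIp b hb).symm
        · exact hm K (by simp [hK])

theorem IsRightBound.exists_forall_ne {x : ℚ} (h : IsRightBound γ x) :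
    ∃ u, x < u ∧ ∀ v, x < v → v < u → γ v ≠ γ x := by
  obtain ⟨P, ⟨⟨h1, h2, h3⟩, -, hc⟩, I, hI, hx, hmax⟩ := h
  obtain ⟨L, M, rfl⟩ := List.append_of_mem hI
  simp only [List.mem_append, List.mem_cons, List.pairwise_append, List.pairwise_cons] at h2 h3
  obtain ⟨-, ⟨hIM, hM⟩, hLM⟩ := h2
  have later {v : ℚ} (hv : x < v) : ∃ K ∈ M, v ∈ K := by
    obtain ⟨K, hK | rfl | hK, hvK⟩ := h3 v
    · exact absurd (hLM K hK I (Or.inl rfl) v hvK x hx) hv.not_gt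
    · exact absurd (hmax hvK) hv.not_ge
    · exact ⟨K, hK, hvK⟩
  cases M with
  | nil => simpa using later (lt_add_one x)
  | cons J M =>
    have hne : ∀ p ∈ I, ∀ q ∈ J, γ p ≠ γ q :=
      List.isChain_iff_forall_rel_of_append_cons_cons.1 hc rfl
    obtain ⟨u, hu⟩ := (h1 J (by simp)).1
    refine ⟨u, hIM J (by simp) x hx u hu, fun v hv hvu => ?_⟩
    obtain ⟨K, hK, hvK⟩ := later hv
    rcases List.mem_cons.1 hK with rfl | hK
    · exact (hne x hx v hvK).symm
    · exact absurd ((List.pairwise_cons.1 hM).1 K hK u hu v hvK) hvu.not_gt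

theorem FinitePW.exists_forall_eq (hγ : FinitePW γ) {x : ℚ} (h : ¬ IsRightBound γ x) :
    ∃ u, x < u ∧ ∀ v, x < v → v < u → γ v = γ x := by
  obtain ⟨P, hP⟩ := hγ.exists_isCanonicalRep
  obtain ⟨I, hI, hx⟩ := hP.1.2.2 x
  have : ∃ u ∈ I, x < u := by
    by_contra! hmax
    exact h ⟨P, hP, I, hI, hx, fun u hu => hmax u hu⟩
  obtain ⟨u, hu, hxu⟩ := this
  exact ⟨u, hxu, fun v hv hvu =>
    hP.2.1 I hI v ((hP.1.1 I hI).2 x hx u hu v hv hvu) x hx⟩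

end Partition

section Gap

variable {S : Type*} {γ : ℚ → S} {s : List Bool} {y : ℚ}

/-- If no break link has an endpoint strictly between `s` and `y`, and `y` is at most the right
child of `s`, then `γ` takes the value `γ y` arbitrarily close to `s` from the right. -/
theorem exists_eq_of_le_right_child
    (hgap : ∀ p p', IsEdge p p' → p' ∈ Set.Ioo (sbVal s) y ∨ p ∈ Set.Ioo (sbVal s) y →
      Monochromatic γ (Set.uIcc p p'))
    (hsy : sbVal s < y) (hy : y ≤ sbVal (s ++ [true])) {u : ℚ} (hu : sbVal s < u) :
    ∃ v, sbVal s < v ∧ v < u ∧ γ v = γ y := by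
  set z : ℕ → ℚ := fun k => sbVal (s ++ true :: List.replicate k false) with hz
  have hxz (k) : sbVal s < z k := sbVal_lt_sbVal_append_true _ _
  have hsucc (k) : s ++ true :: List.replicate (k + 1) false =
      (s ++ true :: List.replicate k false) ++ [false] := by
    rw [List.replicate_succ']; simp
  have hedge (k) : IsEdge (z k) (z (k + 1)) := ⟨_, false, rfl, by rw [hz]; simp only [hsucc]⟩
  have hanti : StrictAnti z := strictAnti_nat_of_succ_lt fun k => by
    rw [hz]; simp only [hsucc]; exact sbVal_append_false_lt _
  have key : ∀ k, z k < y → γ (z k) = γ y := by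
    intro k
    induction k with
    | zero => exact fun h => absurd hy h.not_ge
    | succ k ih =>
      intro hk
      have hmono := hgap _ _ (hedge k) (Or.inl ⟨hxz _, hk⟩)
      rw [Set.uIcc_of_ge (hanti k.lt_succ_self).le] at hmono
      by_cases hky : z k < y
      · rw [← ih hky]
        exact hmono _ (Set.left_mem_Icc.2 (hanti k.lt_succ_self).le) _
          (Set.right_mem_Icc.2 (hanti k.lt_succ_self).le)
      · exact hmono _ (Set.left_mem_Icc.2 (hanti k.lt_succ_self).le) _
          ⟨hk.le, not_lt.1 hky⟩
  obtain ⟨k, hk⟩ := exists_sbVal_append_false_lt (lt_min hu hsy)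
  exact ⟨z k, hxz k, hk.trans_le (min_le_left _ _), key k (hk.trans_le (min_le_right _ _))⟩

/-- If no break link has an endpoint strictly between `s` and its descendant `y`, and `y` exceeds
the right child of `s`, then `γ` takes the same value at `s` and `y`. -/
theorem eq_of_right_child_lt
    (hgap : ∀ p p', IsEdge p p' → p' ∈ Set.Ioo (sbVal s) y ∨ p ∈ Set.Ioo (sbVal s) y →
      Monochromatic γ (Set.uIcc p p'))
    (hr : y * (sbTriple s).2.2.2 < (sbTriple s).2.2.1) (hy : sbVal (s ++ [true]) < y) :
    γ y = γ (sbVal s) := by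
  set w : ℕ → ℚ := fun k => sbVal (s ++ List.replicate k true) with hw
  have hsucc (k) : s ++ List.replicate (k + 1) true =
      (s ++ List.replicate k true) ++ [true] := by
    rw [List.replicate_succ']; simp
  have hedge (k) : IsEdge (w k) (w (k + 1)) := ⟨_, true, rfl, by rw [hw]; simp only [hsucc]⟩
  have hmono : StrictMono w := strictMono_nat_of_lt_succ fun k => by
    rw [hw]; simp only [hsucc]; exact sbVal_lt_sbVal_append_true _ []
  have hw0 : w 0 = sbVal s := by simp [hw]
  have hxw (k) : sbVal s < w (k + 1) := hw0 ▸ hmono k.succ_pos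
  have key : ∀ k, w k < y → γ (w k) = γ (sbVal s) := by
    intro k
    induction k with
    | zero => rw [hw0]; exact fun _ => rfl
    | succ k ih =>
      intro hk
      rw [← ih ((hmono k.lt_succ_self).trans hk)]
      exact hgap _ _ (hedge k) (Or.inl ⟨hxw k, hk⟩) _ Set.right_mem_uIcc _ Set.left_mem_uIcc
  have hex := exists_lt_sbVal_append_true hr
  classical
  obtain ⟨n, hn, hmin⟩ : ∃ n, y < w n ∧ ∀ k < n, ¬ y < w k :=
    ⟨Nat.find hex, Nat.find_spec hex, fun k hk => Nat.find_min hex hk⟩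
  have hw1 : w 1 < y := hy
  obtain ⟨k, rfl⟩ : ∃ k, n = k + 2 := by
    refine ⟨n - 2, ?_⟩
    have : 1 < n := hmono.lt_iff_lt.1 (hw1.trans hn)
    omega
  rcases (not_lt.1 (hmin (k + 1) (by omega))).lt_or_eq with hlt | heq
  · rw [← key _ hlt]
    refine hgap _ _ (hedge (k + 1)) (Or.inr ⟨hxw k, hlt⟩) _ ?_ _ Set.left_mem_uIcc
    exact Set.Icc_subset_uIcc ⟨hlt.le, hn.le⟩
  · obtain _ | k := k
    · exact absurd heq hw1.ne
    · have hlt : w (k + 1) < y := heq ▸ hmono (Nat.lt_succ_self (k + 1))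
      rw [← key _ hlt, ← heq]
      exact hgap _ _ (hedge (k + 1)) (Or.inr ⟨hxw k, hlt⟩) _ Set.right_mem_uIcc _ Set.left_mem_uIcc

end Gap

/-- Proposition 3, part 2: let `γ` be a finite piecewise function and
`D = (q 0, A 0), …, (q (m-1), A (m-1))` with `q` increasing, `γ (q i) = A i`, and such
that both endpoints of every break link of `γ` occur among the `q i`. Then `q i` is a
right-bound of `γ` iff `i + 1 < m`, `q i` is an ancestor of `q (i+1)`, and
`A i ≠ A (i+1)`. -/
theorem right_bound_characterization {S : Type*} [Finite S]
    (γ : ℚ → S) (hγ : FinitePW γ) (m : ℕ) (q : ℕ → ℚ) (A : ℕ → S)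
    (hmono : ∀ i j, i < j → j < m → q i < q j)
    (hlab : ∀ i < m, γ (q i) = A i)
    (hall : ∀ p p' : ℚ, IsBreakLink γ p p' → (∃ i < m, q i = p) ∧ (∃ i < m, q i = p'))
    (i : ℕ) (hi : i < m) :
    IsRightBound γ (q i) ↔
      (i + 1 < m ∧ IsAncestor (q i) (q (i + 1)) ∧ A i ≠ A (i + 1)) := by
  have hlt {a b : ℕ} (ha : a < m) (hab : q a < q b) : a < b := by
    by_contra! hba
    rcases hba.lt_or_eq with hba | rfl
    · exact (hmono b a hba ha).not_gt hab
    · exact hab.false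
  have hgap {s : List Bool} (hs : sbVal s = q i) (p p' : ℚ) (he : IsEdge p p')
      (hp : p' ∈ Set.Ioo (sbVal s) (q (i + 1)) ∨ p ∈ Set.Ioo (sbVal s) (q (i + 1))) :
      Monochromatic γ (Set.uIcc p p') := by
    rw [hs] at hp
    have hno (j : ℕ) (hj : j < m) : q j ∉ Set.Ioo (q i) (q (i + 1)) := fun h => by
      have := hlt hi h.1
      have := hlt hj h.2
      omega
    by_contra hmon
    obtain ⟨⟨j, hj, rfl⟩, ⟨j', hj', rfl⟩⟩ := hall p p' ⟨he, Or.inr hmon⟩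
    exact hp.elim (hno j' hj') (hno j hj)
  constructor
  · intro hb
    obtain ⟨s, hs⟩ := exists_sbVal_eq (q i)
    obtain ⟨u, hu, hne⟩ := hb.exists_forall_ne
    have hz : q i < sbVal (s ++ [true]) := hs ▸ sbVal_lt_sbVal_append_true s []
    obtain ⟨j, hj, hqj⟩ : ∃ j < m, q j = sbVal (s ++ [true]) := by
      refine (hall (q i) _ ⟨⟨s, true, hs, rfl⟩, Or.inr fun hmon => ?_⟩).2
      obtain ⟨v, hv, hv'⟩ := exists_between (lt_min hu hz)
      obtain ⟨hvu, hvz⟩ := lt_min_iff.1 hv'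
      exact hne v hv hvu (hmon v (Set.Icc_subset_uIcc ⟨hv.le, hvz.le⟩) _ Set.left_mem_uIcc)
    have hij : i < j := hlt hi (hqj ▸ hz)
    have hi' : i + 1 < m := by omega
    have hq : q i < q (i + 1) := hmono _ _ i.lt_succ_self hi'
    have hle : q (i + 1) ≤ sbVal (s ++ [true]) := by
      rw [← hqj]
      rcases (Nat.succ_le_of_lt hij).lt_or_eq with h | h
      · exact (hmono _ _ h hj).le
      · exact (congrArg q h).le
    refine ⟨hi', hs ▸ isAncestor_of_le_right_child (hs.symm ▸ hq) hle, ?_⟩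
    obtain ⟨v, hv, hvu, hγv⟩ :=
      exists_eq_of_le_right_child (hgap hs) (hs.symm ▸ hq) hle (hs.symm ▸ hu)
    rw [← hlab i hi, ← hlab _ hi', ← hγv]
    exact (hne v (hs ▸ hv) hvu).symm
  · rintro ⟨hi', ⟨s, t, hs, -, ht⟩, hA⟩
    have hq : q i < q (i + 1) := hmono _ _ i.lt_succ_self hi'
    rw [← hlab i hi, ← hlab _ hi'] at hA
    by_contra hb
    obtain ⟨u, hu, heq⟩ := hγ.exists_forall_eq hb
    rcases le_or_gt (q (i + 1)) (sbVal (s ++ [true])) with hle | hgt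
    · obtain ⟨v, hv, hvu, hγv⟩ :=
        exists_eq_of_le_right_child (hgap hs) (hs.symm ▸ hq) hle (hs.symm ▸ hu)
      exact hA ((heq v (hs ▸ hv) hvu).symm.trans hγv)
    · have hr := ((IsSBState.of_sbTriple s).foldl_between t).2
      rw [← sbVal_append, ht] at hr
      exact hA (hs ▸ (eq_of_right_child_lt (hgap hs) hr hgt).symm)
end

section
/- (Determination by break links; core of Theorem 3.) Let γ, γ′: ℚ → Σ be finite piecewise functions. If γ(x) = γ′(x) for every x ∈ ℚ that is an endpoint of some break link of γ or of some break link of γ′ in the Stern–Brocot tree, then γ = γ′. -/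
theorem sbTriple_append_singleton (s : List Bool) (d : Bool) :
    sbTriple (s ++ [d]) = sbStep (sbTriple s) d := by
  simp [sbTriple]

/-- If `a / b` lies strictly between the bounds of a node of the Stern–Brocot tree other than the
root, then it is attained in the tree. The two cross products measuring the distance from `a / b`
to the bounds are transformed by the subtractive Euclidean algorithm along the search path. -/
theorem exists_sbVal_eq_of_between {a b : ℤ} (hb : 0 < b) (n : ℕ) (s : List Bool)
    {l r : ℤ × ℤ} (hs : sbTriple s = (l, mediant l r, r))
    (hl : 0 ≤ l.2) (hr : 0 ≤ r.2) (hlr : 0 < l.2 + r.2)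
    (hla : 0 < a * l.2 - b * l.1) (har : 0 < r.1 * b - r.2 * a)
    (hn : (a * l.2 - b * l.1) + (r.1 * b - r.2 * a) ≤ n) :
    ∃ t, sbVal t = (a : ℚ) / b := by
  induction n generalizing s l r with
  | zero => push_cast at hn; linarith
  | succ n ih =>
    push_cast at hn
    rcases lt_trichotomy (a * l.2 - b * l.1) (r.1 * b - r.2 * a) with hlt | heq | hgt
    · refine ih (s ++ [false]) (l := l) (r := mediant l r)
        (by rw [sbTriple_append_singleton, hs]; rfl) hl ?_ ?_ hla ?_ ?_ <;>
        simp only [mediant] <;> linarith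
    · refine ⟨s, ?_⟩
      have hden : ((l.2 : ℚ) + r.2) ≠ 0 := by exact_mod_cast hlr.ne'
      have hbq : (b : ℚ) ≠ 0 := by exact_mod_cast hb.ne'
      have heq' : (a : ℚ) * l.2 - b * l.1 = r.1 * b - r.2 * a := by exact_mod_cast heq
      simp only [sbVal, sbNode, hs, mediant]
      push_cast
      rw [div_eq_div_iff hden hbq]
      linarith
    · refine ih (s ++ [true]) (l := mediant l r) (r := r)
        (by rw [sbTriple_append_singleton, hs]; rfl) ?_ hr ?_ ?_ har ?_ <;>
        simp only [mediant] <;> linarith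

theorem sbVal_nil : sbVal [] = 0 := by
  simp [sbVal, sbNode, sbTriple]

/-- Every rational number is a vertex of the Stern–Brocot tree. -/
theorem sbVal_surjective : Function.Surjective sbVal := by
  intro x
  have hb : (0 : ℤ) < x.den := by exact_mod_cast x.pos
  have hx : ((x.num : ℤ) : ℚ) / ((x.den : ℤ) : ℚ) = x := by
    exact_mod_cast x.num_div_den
  rcases lt_trichotomy x.num 0 with hneg | hzero | hpos
  · rw [← hx]
    exact exists_sbVal_eq_of_between hb _ [false] (l := (-1, 0)) (r := (0, 1)) rfl
      (by simp) (by simp) (by simp) (by simpa using hb) (by simpa using hneg)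
      (Int.self_le_toNat _)
  · exact ⟨[], by rw [sbVal_nil, Rat.num_eq_zero.mp hzero]⟩
  · rw [← hx]
    exact exists_sbVal_eq_of_between hb _ [true] (l := (0, 1)) (r := (1, 0)) rfl
      (by simp) (by simp) (by simp) (by simpa using hpos) (by simpa using hb)
      (Int.self_le_toNat _)

/-- determination by break links: if two finite piecewise functions
`γ, γ'` agree on every rational that is an endpoint of some break link of `γ` or of
some break link of `γ'`, then `γ = γ'`. -/
theorem eq_of_agree_on_break_links {S : Type*} [Finite S]
    (γ γ' : ℚ → S) (h : FinitePW γ) (h' : FinitePW γ')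
    (hagree : ∀ p q : ℚ, (IsBreakLink γ p q ∨ IsBreakLink γ' p q) →
      γ p = γ' p ∧ γ q = γ' q) :
    γ = γ' := by
  funext x
  obtain ⟨s, rfl⟩ := sbVal_surjective x
  induction s using List.reverseRecOn with
  | nil =>
    exact (hagree _ (sbVal ([] ++ [true])) (.inl ⟨⟨[], true, rfl, rfl⟩, .inl sbVal_nil⟩)).1
  | append_singleton s d ih =>
    have hedge : IsEdge (sbVal s) (sbVal (s ++ [d])) := ⟨s, d, rfl, rfl⟩
    by_cases hm : Monochromatic γ (Set.uIcc (sbVal s) (sbVal (s ++ [d])))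
    · by_cases hm' : Monochromatic γ' (Set.uIcc (sbVal s) (sbVal (s ++ [d])))
      · rw [← hm _ Set.left_mem_uIcc _ Set.right_mem_uIcc,
          ← hm' _ Set.left_mem_uIcc _ Set.right_mem_uIcc, ih]
      · exact (hagree _ _ (.inr ⟨hedge, .inr hm'⟩)).2
    · exact (hagree _ _ (.inl ⟨hedge, .inr hm⟩)).2
end
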